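/- Let k, k′ ≥ 2 and n ≥ 2 be integers, let χ₁, χ₂ be primitive Dirichlet characters modulo N₁, N₂ and ψ₁, ψ₂ primitive Dirichlet characters modulo M₁, M₂, set N = N₁N₂ and N′ = M₁M₂, and suppose there is a set S of primes with natural density δ(S) > 1/2 such that (σ_{χ₁,χ₂}^{k-1}(p))^n = (σ_{ψ₁,ψ₂}^{k′-1}(p))^n for all p ∈ S. If moreover the characters χ₁χ₂ and ψ₁ψ₂ agree (χ₁(m)χ₂(m) = ψ₁(m)ψ₂(m) for all m), then the character θ := χ₁·ψ̄₁ (mod NN′) satisfies θ² principal, and (σ_{χ₁,χ₂}^{k-1}(p))² = (σ_{ψ₁,ψ₂}^{k′-1}(p))² for all primes p not dividing NN′. -/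

import Mathlib

open Filter

/-- The signed divisor sum `σ_{χ₁,χ₂}^{k-1}(n) = ∑_{d ∣ n} χ₁(n/d) χ₂(d) d^{k-1}`. -/
noncomputable def sigmaC {N₁ N₂ : ℕ} (χ₁ : DirichletCharacter ℂ N₁)
    (χ₂ : DirichletCharacter ℂ N₂) (k : ℕ) (n : ℕ) : ℂ :=
  ∑ d ∈ n.divisors, χ₁ ((n / d : ℕ) : ZMod N₁) * χ₂ ((d : ℕ) : ZMod N₂) * (d : ℂ) ^ (k - 1)

/-- A set `S` of primes has natural density `δ`. -/
def PrimesDensity (S : Set ℕ) (δ : ℝ) : Prop :=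
  Tendsto (fun x : ℕ =>
      ({p : ℕ | p ≤ x ∧ p.Prime ∧ p ∈ S}.ncard : ℝ) / ({p : ℕ | p ≤ x ∧ p.Prime}.ncard : ℝ))
    atTop (nhds δ)

open ArithmeticFunction.vonMangoldt in
/-- As `x → 1⁺`, the Dirichlet series of the von Mangoldt function restricted to an invertible
residue class differs from `(φ(q))⁻¹ / (x - 1)` by a bounded amount. -/
lemma abs_tsum_residueClass_sub_le {q : ℕ} [NeZero q] {a : ZMod q} (ha : IsUnit a) :
    ∃ C : ℝ, ∀ x ∈ Set.Ioc (1 : ℝ) 2,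
      |∑' n, residueClass a n / (n : ℝ) ^ x - (q.totient : ℝ)⁻¹ / (x - 1)| ≤ C := by
  have H {x : ℝ} (hx : 1 < x) :
      ∑' n, residueClass a n / (n : ℝ) ^ x =
        (LFunctionResidueClassAux a x).re + (q.totient : ℝ)⁻¹ / (x - 1) := by
    refine Complex.ofReal_injective ?_
    simp only [Complex.ofReal_tsum, Complex.ofReal_div, Complex.ofReal_cpow (Nat.cast_nonneg _),
      Complex.ofReal_natCast, Complex.ofReal_add, Complex.ofReal_inv, Complex.ofReal_sub,
      Complex.ofReal_one]
    simp_rw [← LFunctionResidueClassAux_real ha hx,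
      eqOn_LFunctionResidueClassAux ha <| Set.mem_ofPred.mpr (Complex.ofReal_re x ▸ hx),
      sub_add_cancel, LSeries, LSeries.term]
    refine tsum_congr fun n ↦ ?_
    split_ifs with hn
    · simp only [hn, residueClass_apply_zero, Complex.ofReal_zero, zero_div]
    · rfl
  have hcont : ContinuousOn (fun x : ℝ ↦ (LFunctionResidueClassAux a x).re) (Set.Icc 1 2) :=
    Complex.continuous_re.continuousOn.comp (t := Set.univ)
      (continuousOn_LFunctionResidueClassAux a) (fun ⦃x⦄ a ↦ trivial) |>.comp
      Complex.continuous_ofReal.continuousOn fun x hx ↦ by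
        simpa only [Set.mem_ofPred_eq, Complex.ofReal_re] using hx.1
  obtain ⟨C, hC⟩ := isCompact_Icc.exists_bound_of_continuousOn hcont
  refine ⟨C, fun x hx ↦ ?_⟩
  rw [H hx.1, add_sub_cancel_right]
  exact hC x (Set.Ioc_subset_Icc_self hx)

/-- Abel's inequality: a weighted sum with nonnegative decreasing weights is controlled by an upper
bound for the partial sums. -/
lemma sum_range_mul_le_of_antitone {a f : ℕ → ℝ} {K : ℝ} (hf : Antitone f) (hf₀ : ∀ n, 0 ≤ f n)
    (ha : ∀ n, ∑ i ∈ Finset.range n, a i ≤ K) (n : ℕ) :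
    ∑ i ∈ Finset.range n, a i * f i ≤ K * f 0 := by
  suffices h : ∀ n, ∑ i ∈ Finset.range n, a i * f i ≤
      K * f 0 - (K - ∑ i ∈ Finset.range n, a i) * f n from
    (h n).trans (sub_le_self _ (mul_nonneg (sub_nonneg.2 (ha n)) (hf₀ n)))
  intro n
  induction n with
  | zero => simp
  | succ n ih =>
    have h1 := mul_le_mul_of_nonneg_left (hf n.le_succ) (sub_nonneg.2 (ha (n + 1)))
    rw [Finset.sum_range_succ] at h1 ⊢
    rw [Finset.sum_range_succ]
    simp only [Nat.succ_eq_add_one] at h1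
    nlinarith

lemma antitone_log_div_rpow_three_add {x : ℝ} (hx : 1 ≤ x) :
    Antitone fun n : ℕ ↦ Real.log ((3 + n : ℕ) : ℝ) / ((3 + n : ℕ) : ℝ) ^ x := by
  have key : ∀ n : ℕ, Real.exp x⁻¹ ≤ ((3 + n : ℕ) : ℝ) := fun n ↦ by
    have h1 : Real.exp x⁻¹ ≤ Real.exp 1 :=
      Real.exp_le_exp.2 (inv_le_one_of_one_le₀ hx)
    have h2 := Real.exp_one_lt_d9
    push_cast
    have : (0 : ℝ) ≤ n := n.cast_nonneg
    linarith
  intro m n hmn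
  exact Real.log_div_self_rpow_antitoneOn (by linarith : 0 < x) (key m) (key n)
    (by exact_mod_cast Nat.add_le_add_left hmn 3)

lemma log_div_rpow_le_one {x : ℝ} (hx : 1 ≤ x) (n : ℕ) :
    Real.log n / (n : ℝ) ^ x ≤ 1 := by
  rcases n.eq_zero_or_pos with rfl | hn
  · simp
  have h1 : (1 : ℝ) ≤ n := by exact_mod_cast hn
  rw [div_le_one (by positivity)]
  calc Real.log n ≤ n := Real.log_le_self n.cast_nonneg
    _ = (n : ℝ) ^ (1 : ℝ) := (Real.rpow_one _).symm
    _ ≤ _ := Real.rpow_le_rpow_of_exponent_le h1 hx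

open ArithmeticFunction.vonMangoldt in
lemma summable_residueClass_div_rpow {q : ℕ} (a : ZMod q) {x : ℝ} (hx : 1 < x) :
    Summable fun n : ℕ ↦ residueClass a n / (n : ℝ) ^ x :=
  LSeries.summable_real_of_abscissaOfAbsConv_lt <|
    (abscissaOfAbsConv_residueClass_le_one a).trans_lt <| mod_cast hx

open ArithmeticFunction.vonMangoldt in
/-- If a weight function on the invertible residue classes mod `q` has bounded above partial sums
along the primes, then its total weight is nonpositive. -/
lemma sum_units_nonpos_of_prime_sum_le {q : ℕ} [NeZero q] (w : (ZMod q)ˣ → ℝ) (K : ℝ)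
    (hK : ∀ n, ∑ p ∈ Finset.range n with p.Prime,
      ∑ a : (ZMod q)ˣ, (if (p : ZMod q) = a then w a else 0) ≤ K) :
    ∑ a, w a ≤ 0 := by
  set b : ℕ → ℝ := fun p ↦ if p.Prime then
    ∑ a : (ZMod q)ˣ, (if (p : ZMod q) = a then w a else 0) else 0 with hb
  replace hK : ∀ n, ∑ p ∈ Finset.range n, b p ≤ K := fun n ↦ by
    simpa only [hb, Finset.sum_filter] using hK n
  have hK₀ : 0 ≤ K := by simpa using hK 0
  -- the contribution of the primes
  obtain ⟨C₁, hC₁⟩ : ∃ C, ∀ x : ℝ, 1 ≤ x → ∀ n,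
      ∑ p ∈ Finset.range (3 + n), b p * (Real.log p / (p : ℝ) ^ x) ≤ C := by
    set B := ∑ p ∈ Finset.range 3, |b p| with hB
    have hB₀ : 0 ≤ B := Finset.sum_nonneg fun _ _ ↦ abs_nonneg _
    have hf₀ : ∀ x : ℝ, ∀ n : ℕ, 0 ≤ Real.log n / (n : ℝ) ^ x := fun x n ↦
      div_nonneg (Real.log_natCast_nonneg n) (by positivity)
    refine ⟨B + (K + B), fun x hx n ↦ ?_⟩
    rw [Finset.sum_range_add]
    refine add_le_add (Finset.sum_le_sum fun p _ ↦ ?_) ?_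
    · calc b p * (Real.log p / (p : ℝ) ^ x) ≤ |b p| * (Real.log p / (p : ℝ) ^ x) :=
            mul_le_mul_of_nonneg_right (le_abs_self _) (hf₀ x p)
        _ ≤ |b p| := mul_le_of_le_one_right (abs_nonneg _) (log_div_rpow_le_one hx p)
    · refine (sum_range_mul_le_of_antitone (a := fun i ↦ b (3 + i)) (K := K + B)
        (antitone_log_div_rpow_three_add hx) (fun n ↦ hf₀ x _) (fun m ↦ ?_) n).trans
        (mul_le_of_le_one_right (by positivity) (log_div_rpow_le_one hx _))
      have h1 := hK (3 + m)
      rw [Finset.sum_range_add] at h1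
      have h2 : -B ≤ ∑ p ∈ Finset.range 3, b p :=
        neg_le_of_abs_le (Finset.abs_sum_le_sum_abs _ _)
      linarith
  -- the contribution of the other prime powers
  obtain ⟨C₂, hC₂⟩ : ∃ C, ∀ x : ℝ, 1 ≤ x → ∀ n, ∑ m ∈ Finset.range n, ∑ a : (ZMod q)ˣ,
      w a * ((if m.Prime then 0 else residueClass (a : ZMod q) m) / (m : ℝ) ^ x) ≤ C := by
    refine ⟨∑ a : (ZMod q)ˣ, |w a| * ∑' m : ℕ,
      (if m.Prime then 0 else residueClass (a : ZMod q) m) / (m : ℝ), fun x hx n ↦ ?_⟩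
    rw [Finset.sum_comm]
    refine Finset.sum_le_sum fun a _ ↦ ?_
    have h0 : ∀ m : ℕ, 0 ≤ (if m.Prime then 0 else residueClass (a : ZMod q) m) := fun m ↦ by
      split_ifs
      exacts [le_rfl, residueClass_nonneg _ m]
    have h1 : ∀ m : ℕ, (if m.Prime then 0 else residueClass (a : ZMod q) m) / (m : ℝ) ^ x ≤
        (if m.Prime then 0 else residueClass (a : ZMod q) m) / (m : ℝ) := fun m ↦ by
      rcases m.eq_zero_or_pos with rfl | hm
      · simp
      refine div_le_div_of_nonneg_left (h0 m) (mod_cast hm) ?_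
      conv_lhs => rw [← Real.rpow_one (m : ℝ)]
      exact Real.rpow_le_rpow_of_exponent_le (by norm_cast) hx
    rw [← Finset.mul_sum]
    refine mul_le_mul (le_abs_self _) ((Finset.sum_le_sum fun m _ ↦ h1 m).trans ?_)
      (Finset.sum_nonneg fun m _ ↦ div_nonneg (h0 m) (by positivity)) (abs_nonneg _)
    exact (summable_residueClass_non_primes_div (a : ZMod q)).sum_le_tsum _
      fun m _ ↦ div_nonneg (h0 m) m.cast_nonneg
  have hsplit : ∀ (x : ℝ) (m : ℕ),
      ∑ a : (ZMod q)ˣ, w a * (residueClass (a : ZMod q) m / (m : ℝ) ^ x) =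
      b m * (Real.log m / (m : ℝ) ^ x) + ∑ a : (ZMod q)ˣ,
        w a * ((if m.Prime then 0 else residueClass (a : ZMod q) m) / (m : ℝ) ^ x) := by
    intro x m
    by_cases hm : m.Prime
    · simp only [hb, hm, if_true, zero_div, mul_zero, Finset.sum_const_zero, add_zero,
        Finset.sum_mul]
      refine Finset.sum_congr rfl fun a _ ↦ ?_
      by_cases ha : (m : ZMod q) = a
      · simp [residueClass, ha, ArithmeticFunction.vonMangoldt_apply_prime hm]
      · simp [residueClass, ha]
    · simp [hb, hm]
  have htsum : ∀ x : ℝ, 1 < x →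
      ∑ a : (ZMod q)ˣ, w a * ∑' m, residueClass (a : ZMod q) m / (m : ℝ) ^ x ≤ C₁ + C₂ := by
    intro x hx
    have hs : HasSum (fun m : ℕ ↦
        ∑ a : (ZMod q)ˣ, w a * (residueClass (a : ZMod q) m / (m : ℝ) ^ x))
        (∑ a : (ZMod q)ˣ, w a * ∑' m, residueClass (a : ZMod q) m / (m : ℝ) ^ x) :=
      hasSum_sum fun a _ ↦ (summable_residueClass_div_rpow _ hx).hasSum.mul_left _
    have ht := hs.tendsto_sum_nat.comp (tendsto_add_atTop_nat 3)
    refine le_of_tendsto' ht fun n ↦ ?_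
    simp only [Function.comp_apply, hsplit, Finset.sum_add_distrib]
    refine add_le_add ?_ (hC₂ x hx.le _)
    rw [add_comm n 3]
    exact hC₁ x hx.le n
  choose C hC using fun a : (ZMod q)ˣ ↦ abs_tsum_residueClass_sub_le (q := q) a.isUnit
  set D := C₁ + C₂ + ∑ a, |w a| * C a with hD
  have hbound : ∀ x ∈ Set.Ioc (1 : ℝ) 2, (∑ a, w a) * ((q.totient : ℝ)⁻¹ / (x - 1)) ≤ D := by
    intro x hx
    rw [hD, Finset.sum_mul, ← sub_le_iff_le_add, ← Finset.sum_sub_distrib]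
    refine (Finset.sum_le_sum fun a _ ↦ ?_).trans (htsum x hx.1)
    have h1 := mul_le_mul_of_nonneg_left (hC a x hx) (abs_nonneg (w a))
    rw [← abs_mul] at h1
    have h2 := neg_le_of_abs_le h1
    linarith [mul_sub (w a) (∑' m, residueClass (a : ZMod q) m / (m : ℝ) ^ x)
      ((q.totient : ℝ)⁻¹ / (x - 1))]
  by_contra! hpos
  have hφ : 0 < (q.totient : ℝ)⁻¹ := inv_pos.2 (mod_cast q.totient.pos_of_neZero)
  set A := (∑ a, w a) * (q.totient : ℝ)⁻¹ with hA
  have hA₀ : 0 < A := mul_pos hpos hφ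
  have hAD : ∀ t ∈ Set.Ioc (0 : ℝ) 1, A ≤ D * t := fun t ht ↦ by
    have := hbound (1 + t) ⟨by linarith [ht.1], by linarith [ht.2]⟩
    rwa [add_sub_cancel_left, ← mul_div_assoc, div_le_iff₀ ht.1] at this
  have hD₁ : A ≤ D := by simpa using hAD 1 (by norm_num)
  have hD₀ : 0 < D := hA₀.trans_le hD₁
  have h := hAD (A / (2 * D)) ⟨by positivity, by rw [div_le_one (by positivity)]; linarith⟩
  rw [mul_div_assoc', mul_comm D A, mul_comm 2 D, ← div_div, mul_div_cancel_right₀ _ hD₀.ne'] at h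
  linarith

lemma ncard_setOf_le_prime_and (P : ℕ → Prop) [DecidablePred P] (x : ℕ) :
    {p : ℕ | p ≤ x ∧ p.Prime ∧ P p}.ncard =
      (((Finset.range (x + 1)).filter Nat.Prime).filter P).card := by
  rw [← Set.ncard_coe_finset]
  congr 1
  ext p
  simp [and_assoc]

lemma exists_prime_sum_sub_ite_le {S : Set ℕ} {δ c : ℝ} (h : PrimesDensity S δ)
    (hc₀ : 0 < c) (hc : c < δ) [DecidablePred (· ∈ S)] :
    ∃ K : ℝ, ∀ n, ∑ p ∈ Finset.range n with p.Prime, (c - if p ∈ S then 1 else 0) ≤ K := by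
  obtain ⟨T, hT⟩ := eventually_atTop.1 (h.eventually (lt_mem_nhds hc))
  refine ⟨c * (T + 1), fun n ↦ ?_⟩
  have hsum : ∀ n, ∑ p ∈ Finset.range n with p.Prime, (c - if p ∈ S then (1 : ℝ) else 0) =
      c * ((Finset.range n).filter Nat.Prime).card -
      (((Finset.range n).filter Nat.Prime).filter (· ∈ S)).card := fun n ↦ by
    rw [Finset.sum_sub_distrib, Finset.sum_const, nsmul_eq_mul, Finset.sum_boole, mul_comm]
  rw [hsum]
  rcases le_or_gt n (T + 1) with hn | hn
  · have h1 : ((Finset.range n).filter Nat.Prime).card ≤ T + 1 :=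
      (Finset.card_filter_le _ _).trans (by simpa using hn)
    have h2 : (((Finset.range n).filter Nat.Prime).card : ℝ) ≤ T + 1 := by exact_mod_cast h1
    have h3 := mul_le_mul_of_nonneg_left h2 hc₀.le
    have h4 : (0 : ℝ) ≤ (((Finset.range n).filter Nat.Prime).filter (· ∈ S)).card := by positivity
    linarith
  · obtain ⟨x, rfl⟩ : ∃ x, n = x + 1 := ⟨n - 1, by omega⟩
    have h1 := hT x (by omega)
    have h2 := ncard_setOf_le_prime_and (fun _ ↦ True) x
    simp only [and_true, Finset.filter_true] at h2
    rw [ncard_setOf_le_prime_and, h2] at h1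
    have h3 : (0 : ℝ) < ((Finset.range (x + 1)).filter Nat.Prime).card := by
      refine lt_of_le_of_ne (by positivity) fun h0 ↦ ?_
      rw [← h0, div_zero] at h1
      linarith
    rw [lt_div_iff₀ h3] at h1
    have : (0 : ℝ) ≤ c * (T + 1) := by positivity
    linarith

/-- A set of primes which, up to finitely many elements, lies in a set `H` of invertible residue
classes mod `q` has density at most `#H / φ(q)`. -/
lemma mul_totient_le_card_of_primesDensity {q : ℕ} [NeZero q] {S : Set ℕ} {δ : ℝ}
    (h : PrimesDensity S δ) (H : Finset (ZMod q)ˣ)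
    (hH : ∀ᶠ p in atTop, p.Prime → p ∈ S → ∃ a ∈ H, (p : ZMod q) = (a : ZMod q)) :
    δ * q.totient ≤ H.card := by
  classical
  have hφ : (0 : ℝ) < q.totient := mod_cast q.totient.pos_of_neZero
  rw [← le_div_iff₀ hφ]
  refine le_of_forall_lt_imp_le_of_dense fun c hc ↦ ?_
  rw [le_div_iff₀ hφ]
  rcases le_or_gt c 0 with hc₀ | hc₀
  · exact (mul_nonpos_of_nonpos_of_nonneg hc₀ hφ.le).trans (by positivity)
  obtain ⟨K, hK⟩ := exists_prime_sum_sub_ite_le h hc₀ hc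
  obtain ⟨P, hP⟩ := eventually_atTop.1 hH
  have hw := sum_units_nonpos_of_prime_sum_le (q := q) (fun a ↦ c - if a ∈ H then 1 else 0)
    (K + P) fun n ↦ ?_
  · rw [Finset.sum_sub_distrib, Finset.sum_const, nsmul_eq_mul, Finset.sum_boole,
      Finset.card_univ, ZMod.card_units_eq_totient, Finset.filter_mem_eq_inter,
      Finset.univ_inter] at hw
    linarith
  · have key : ∀ p ∈ (Finset.range n).filter Nat.Prime,
        ∑ a : (ZMod q)ˣ, (if (p : ZMod q) = a then c - (if a ∈ H then (1 : ℝ) else 0) else 0) ≤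
        (c - if p ∈ S then 1 else 0) + if p < P then 1 else 0 := by
      intro p hp
      have hp' := (Finset.mem_filter.1 hp).2
      by_cases hu : IsUnit (p : ZMod q)
      · obtain ⟨u, hu⟩ := hu
        rw [Finset.sum_eq_single u (fun a _ ha ↦ if_neg fun hpa ↦
            ha (Units.ext (hpa.symm.trans hu.symm))) (fun h ↦ absurd (Finset.mem_univ _) h), if_pos hu.symm]
        by_cases hpP : p < P
        · split_ifs <;> linarith
        · by_cases hpS : p ∈ S
          · obtain ⟨a, ha, hpa⟩ := hP p (not_lt.1 hpP) hp' hpS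
            have : u = a := Units.ext (hu.trans hpa)
            subst this
            simp [ha, hpS, hpP]
          · simp only [hpS, hpP, if_false]
            split_ifs <;> linarith
      · rw [Finset.sum_eq_zero fun a _ ↦ if_neg fun hpa ↦ hu ⟨a, hpa.symm⟩]
        by_cases hpP : p < P
        · simp only [hpP, if_true]
          split_ifs <;> linarith
        · have hpS : p ∉ S := fun hpS ↦ by
            obtain ⟨a, -, hpa⟩ := hP p (not_lt.1 hpP) hp' hpS
            exact hu (hpa ▸ a.isUnit)
          simp [hpS, hpP, hc₀.le]
    refine (Finset.sum_le_sum key).trans ?_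
    rw [Finset.sum_add_distrib]
    refine add_le_add (hK n) ?_
    rw [Finset.sum_boole]
    have : (((Finset.range n).filter Nat.Prime).filter (· < P)).card ≤ P := by
      simpa using Finset.card_le_card (t := Finset.range P) (s :=
        ((Finset.range n).filter Nat.Prime).filter (· < P)) fun p hp ↦
        Finset.mem_range.2 (Finset.mem_filter.1 hp).2
    exact_mod_cast this

lemma frequently_prime_mem_of_primesDensity {S : Set ℕ} {δ : ℝ} (h : PrimesDensity S δ)
    (hδ : 0 < δ) : ∃ᶠ p in atTop, p.Prime ∧ p ∈ S := by
  by_contra hS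
  have := mul_totient_le_card_of_primesDensity (q := 1) h ∅ <| by
    filter_upwards [not_frequently.1 hS] with p hp hp' hpS using absurd ⟨hp', hpS⟩ hp
  simp at this
  linarith

lemma sigmaC_prime {N₁ N₂ : ℕ} (χ₁ : DirichletCharacter ℂ N₁) (χ₂ : DirichletCharacter ℂ N₂)
    (k : ℕ) {p : ℕ} (hp : p.Prime) :
    sigmaC χ₁ χ₂ k p = χ₁ p + χ₂ p * (p : ℂ) ^ (k - 1) := by
  rw [sigmaC, hp.divisors, Finset.sum_pair hp.one_lt.ne]
  simp [Nat.div_self hp.pos]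

lemma DirichletCharacter.sq_eq_one_of_level_eq_zero {L : ℕ} (hL : L = 0)
    (θ : DirichletCharacter ℂ L) : θ ^ 2 = 1 := by
  subst hL
  refine MulChar.ext fun u ↦ ?_
  rw [MulChar.pow_apply_coe, MulChar.one_apply_coe, ← map_pow, ← Units.val_pow_eq_pow_val,
    show u ^ 2 = 1 from Int.units_sq u, Units.val_one, map_one]

lemma DirichletCharacter.changeLevel_natCast {N L : ℕ} (h : N ∣ L) (χ : DirichletCharacter ℂ N)
    {p : ℕ} (hp : p.Coprime L) : changeLevel h χ (p : ZMod L) = χ (p : ZMod N) := by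
  simpa using changeLevel_eq_cast_of_dvd' χ h (a := (p : ℤ)) (Nat.isCoprime_iff_coprime.2 hp)

lemma DirichletCharacter.norm_natCast_eq_one {N p : ℕ} (χ : DirichletCharacter ℂ N)
    (hp : p.Coprime N) : ‖χ (p : ZMod N)‖ = 1 := by
  simpa using χ.unit_norm_eq_one (ZMod.unitOfCoprime p hp)

lemma exponent_le_of_pow_eq {a₁ a₂ b₁ b₂ : ℂ} (ha₁ : ‖a₁‖ = 1) (ha₂ : ‖a₂‖ = 1) (hb₁ : ‖b₁‖ = 1)
    (hb₂ : ‖b₂‖ = 1) {p n e e' : ℕ} (hp : 3 ≤ p) (hn : n ≠ 0) (he : e ≠ 0)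
    (h : (a₁ + a₂ * (p : ℂ) ^ e) ^ n = (b₁ + b₂ * (p : ℂ) ^ e') ^ n) : e' ≤ e := by
  by_contra! hlt
  have h1 : ‖a₁ + a₂ * (p : ℂ) ^ e‖ = ‖b₁ + b₂ * (p : ℂ) ^ e'‖ :=
    (pow_left_inj₀ (norm_nonneg _) (norm_nonneg _) hn).1 (by rw [← norm_pow, ← norm_pow, h])
  have h2 : ‖a₁ + a₂ * (p : ℂ) ^ e‖ ≤ 1 + (p : ℝ) ^ e := by
    simpa [ha₁, ha₂] using norm_add_le a₁ (a₂ * (p : ℂ) ^ e)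
  have h3 : (p : ℝ) ^ e' - 1 ≤ ‖b₁ + b₂ * (p : ℂ) ^ e'‖ := by
    simpa [hb₁, hb₂, add_comm] using norm_sub_le_norm_add (b₂ * (p : ℂ) ^ e') b₁
  have hp' : (3 : ℝ) ≤ p := mod_cast hp
  have h4 : (p : ℝ) ^ (e + 1) ≤ (p : ℝ) ^ e' := pow_le_pow_right₀ (by linarith) hlt
  have h5 : (p : ℝ) ≤ (p : ℝ) ^ e := le_self_pow₀ (by linarith) he
  rw [pow_succ] at h4
  nlinarith

lemma sq_eq_sq_of_pow_eq {a₁ a₂ b₁ b₂ : ℂ} (ha₁ : ‖a₁‖ = 1) (hb₁ : ‖b₁‖ = 1)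
    (hb₂ : ‖b₂‖ = 1) (hab : a₁ * a₂ = b₁ * b₂) {n : ℕ} (hn : n ≠ 0) {c Q : ℝ} (hQ : 1 < Q)
    (hcQ : 2 < c * Q) (hc : ∀ ζ : ℂ, ζ ^ n = 1 → a₂ - ζ * b₂ ≠ 0 → c ≤ ‖a₂ - ζ * b₂‖)
    (h : (a₁ + a₂ * (Q : ℂ)) ^ n = (b₁ + b₂ * (Q : ℂ)) ^ n) : a₁ ^ 2 = b₁ ^ 2 := by
  have hQ' : ‖(Q : ℂ)‖ = Q := by simp [abs_of_pos (zero_lt_one.trans hQ)]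
  have hB : b₁ + b₂ * (Q : ℂ) ≠ 0 := fun h0 ↦ by
    have h1 := congrArg norm (eq_neg_of_add_eq_zero_left h0)
    rw [norm_neg, norm_mul, hb₁, hb₂, hQ'] at h1
    linarith
  obtain ⟨ζ, hζ⟩ : ∃ ζ, a₁ + a₂ * (Q : ℂ) = ζ * (b₁ + b₂ * (Q : ℂ)) :=
    ⟨_, (div_mul_cancel₀ _ hB).symm⟩
  have hζn : ζ ^ n = 1 := by
    rw [hζ, mul_pow] at h
    exact (mul_eq_right₀ (pow_ne_zero _ hB)).1 h
  have hζ₁ : ‖ζ‖ = 1 := Complex.norm_eq_one_of_pow_eq_one hζn hn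
  have h1 : (a₂ - ζ * b₂) * Q = ζ * b₁ - a₁ := by linear_combination hζ
  have h2 : a₂ - ζ * b₂ = 0 := by
    by_contra hne
    have h3 := hc ζ hζn hne
    have h4 : ‖a₂ - ζ * b₂‖ * Q ≤ 2 := by
      calc ‖a₂ - ζ * b₂‖ * Q = ‖ζ * b₁ - a₁‖ := by rw [← h1, norm_mul, hQ']
        _ ≤ ‖ζ * b₁‖ + ‖a₁‖ := norm_sub_le _ _
        _ = 2 := by rw [norm_mul, hζ₁, hb₁, ha₁]; norm_num
    nlinarith
  rw [h2, zero_mul] at h1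
  have hb₁' : b₁ ≠ 0 := fun h ↦ by simp [h] at hb₁
  have hb₂' : b₂ ≠ 0 := fun h ↦ by simp [h] at hb₂
  have h5 : ζ ^ 2 = 1 := by
    refine mul_right_cancel₀ (mul_ne_zero hb₁' hb₂') ?_
    linear_combination hab - a₂ * h1 - ζ * b₁ * h2
  linear_combination (a₁ + ζ * b₁) * h1 + b₁ ^ 2 * h5

lemma Set.Finite.exists_pos_le_norm {F : Set ℂ} (hF : F.Finite) :
    ∃ c > 0, ∀ z ∈ F, z ≠ 0 → c ≤ ‖z‖ := by
  have : (F \ {0})ᶜ ∈ nhds (0 : ℂ) :=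
    (hF.subset Set.sdiff_subset).isClosed.isOpen_compl.mem_nhds (by simp)
  obtain ⟨c, hc, hball⟩ := Metric.mem_nhds_iff.1 this
  refine ⟨c, hc, fun z hz hz₀ ↦ ?_⟩
  by_contra! hlt
  exact hball (mem_ball_zero_iff.2 hlt) ⟨hz, hz₀⟩

lemma DirichletCharacter.exists_pos_le_norm_sub {N M n : ℕ} [NeZero N] [NeZero M] (hn : n ≠ 0)
    (χ : DirichletCharacter ℂ N) (ψ : DirichletCharacter ℂ M) :
    ∃ c > 0, ∀ x y (ζ : ℂ), ζ ^ n = 1 → χ x - ζ * ψ y ≠ 0 → c ≤ ‖χ x - ζ * ψ y‖ := by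
  have hroots : {ζ : ℂ | ζ ^ n = 1}.Finite :=
    ((Polynomial.nthRoots n (1 : ℂ)).toFinset.finite_toSet).subset fun ζ hζ ↦ by
      simpa [Polynomial.mem_nthRoots (Nat.pos_of_ne_zero hn)] using hζ
  obtain ⟨c, hc, h⟩ := (((Set.finite_univ (α := ZMod N)).prod
    ((Set.finite_univ (α := ZMod M)).prod hroots)).image
    fun t ↦ χ t.1 - t.2.2 * ψ t.2.1).exists_pos_le_norm
  exact ⟨c, hc, fun x y ζ hζ ↦ h _ ⟨(x, y, ζ), by simpa using hζ, rfl⟩⟩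

lemma MonoidHom.eq_one_of_card_lt {G M : Type*} [Group G] [Finite G] [Monoid M] (f : G →* M)
    (h : Nat.card G < 2 * Nat.card f.ker) : f = 1 := by
  have h1 := f.ker.card_mul_index
  have h2 : f.ker.index = 1 := by
    have h3 : f.ker.index ≠ 0 := Subgroup.index_ne_zero_of_finite
    have h4 : f.ker.index < 2 := by
      by_contra! h5
      have := Nat.mul_le_mul_left (Nat.card f.ker) h5
      omega
    omega
  rw [Subgroup.index_eq_one, MonoidHom.ker_eq_top_iff] at h2
  exact h2

/-- A Dirichlet character which is trivial on a set of primes of density greater than `1/2`, up to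
finitely many exceptions, is trivial. -/
lemma DirichletCharacter.eq_one_of_primesDensity {q : ℕ} [NeZero q] (χ : DirichletCharacter ℂ q)
    {S : Set ℕ} {δ : ℝ} (h : PrimesDensity S δ) (hδ : 1 / 2 < δ)
    (hχ : ∀ᶠ p in atTop, p.Prime → p ∈ S → χ (p : ZMod q) = 1) : χ = 1 := by
  classical
  have h1 := mul_totient_le_card_of_primesDensity h
    (Finset.univ.filter (· ∈ χ.toUnitHom.ker)) <| by
    filter_upwards [hχ] with p hp hpp hpS
    have hχp := hp hpp hpS
    have hu : IsUnit (p : ZMod q) := by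
      by_contra hu
      rw [χ.map_nonunit hu] at hχp
      exact zero_ne_one hχp
    refine ⟨hu.unit, ?_, rfl⟩
    simp only [Finset.mem_filter, Finset.mem_univ, true_and, MonoidHom.mem_ker]
    ext
    simpa using hχp
  have h2 : χ.toUnitHom = 1 := by
    refine MonoidHom.eq_one_of_card_lt _ ?_
    have hφ : (0 : ℝ) < q.totient := mod_cast q.totient.pos_of_neZero
    rw [Nat.card_eq_fintype_card, ZMod.card_units_eq_totient, Nat.card_eq_fintype_card,
      Fintype.card_subtype]
    have : (q.totient : ℝ) < 2 *
      ((Finset.univ.filter (· ∈ χ.toUnitHom.ker)).card : ℝ) := by nlinarith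
    exact_mod_cast this
  refine MulChar.ext fun u ↦ ?_
  rw [← MulChar.coe_toUnitHom, h2]
  simp

/-- In the setting of the `n`-th power multiplicity-one theorem, if moreover `χ₁χ₂ = ψ₁ψ₂`,
then the character `θ := χ₁·ψ̄₁` (mod `NN'`) has principal square and
`(σ_{χ₁,χ₂}^{k-1}(p))² = (σ_{ψ₁,ψ₂}^{k'-1}(p))²` for all primes `p ∤ NN'`. -/
theorem stmt_12 (k k' n : ℕ) (hk : 2 ≤ k) (hk' : 2 ≤ k') (hn : 2 ≤ n)
    (N₁ N₂ M₁ M₂ : ℕ)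
    (χ₁ : DirichletCharacter ℂ N₁) (χ₂ : DirichletCharacter ℂ N₂)
    (ψ₁ : DirichletCharacter ℂ M₁) (ψ₂ : DirichletCharacter ℂ M₂)
    (hχ₁ : χ₁.IsPrimitive) (hχ₂ : χ₂.IsPrimitive)
    (hψ₁ : ψ₁.IsPrimitive) (hψ₂ : ψ₂.IsPrimitive)
    (S : Set ℕ) (hSp : ∀ p ∈ S, p.Prime) (δ : ℝ) (hδ : 1 / 2 < δ)
    (hdens : PrimesDensity S δ)
    (heq : ∀ p ∈ S, (sigmaC χ₁ χ₂ k p) ^ n = (sigmaC ψ₁ ψ₂ k' p) ^ n)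
    (hprod : ∀ m : ℕ, χ₁ (m : ZMod N₁) * χ₂ (m : ZMod N₂) =
      ψ₁ (m : ZMod M₁) * ψ₂ (m : ZMod M₂)) :
    ((DirichletCharacter.changeLevel
        (show N₁ ∣ (N₁ * N₂) * (M₁ * M₂) from ⟨N₂ * (M₁ * M₂), by ring⟩) χ₁) *
      (DirichletCharacter.changeLevel
        (show M₁ ∣ (N₁ * N₂) * (M₁ * M₂) from ⟨(N₁ * N₂) * M₂, by ring⟩)
        (ψ₁.ringHomComp (starRingEnd ℂ)))) ^ 2 = 1 ∧
    ∀ p : ℕ, p.Prime → ¬(p ∣ (N₁ * N₂) * (M₁ * M₂)) →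
      (sigmaC χ₁ χ₂ k p) ^ 2 = (sigmaC ψ₁ ψ₂ k' p) ^ 2 := by
  rcases eq_or_ne ((N₁ * N₂) * (M₁ * M₂)) 0 with hL | hL
  · exact ⟨DirichletCharacter.sq_eq_one_of_level_eq_zero hL _,
      fun p _ hpL ↦ absurd (hL ▸ dvd_zero p) hpL⟩
  have hL' := hL
  simp only [mul_ne_zero_iff] at hL'
  obtain ⟨⟨hN₁, hN₂⟩, hM₁, hM₂⟩ := hL'
  have : NeZero ((N₁ * N₂) * (M₁ * M₂)) := ⟨hL⟩
  have : NeZero N₂ := ⟨hN₂⟩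
  have : NeZero M₂ := ⟨hM₂⟩
  have hn₀ : n ≠ 0 := by omega
  have hcop : ∀ p : ℕ, p.Coprime ((N₁ * N₂) * (M₁ * M₂)) →
      (p.Coprime N₁ ∧ p.Coprime N₂) ∧ p.Coprime M₁ ∧ p.Coprime M₂ := fun p hp ↦ by
    simpa only [Nat.coprime_mul_iff_right] using hp
  have hlarge : ∀ᶠ p : ℕ in atTop, p.Prime → p.Coprime ((N₁ * N₂) * (M₁ * M₂)) := by
    filter_upwards [eventually_gt_atTop ((N₁ * N₂) * (M₁ * M₂))] with p hp hpp
    exact (Nat.Prime.coprime_iff_not_dvd hpp).2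
      (Nat.not_dvd_of_pos_of_lt (Nat.pos_of_ne_zero hL) hp)
  obtain rfl : k = k' := by
    obtain ⟨p, ⟨hpp, hpS⟩, hp, hp3⟩ := ((frequently_prime_mem_of_primesDensity hdens
      (by linarith)).and_eventually (hlarge.and (eventually_ge_atTop 3))).exists
    obtain ⟨⟨h1, h2⟩, h3, h4⟩ := hcop p (hp hpp)
    have h := heq p hpS
    rw [sigmaC_prime _ _ _ hpp, sigmaC_prime _ _ _ hpp] at h
    have h5 := exponent_le_of_pow_eq (χ₁.norm_natCast_eq_one h1) (χ₂.norm_natCast_eq_one h2)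
      (ψ₁.norm_natCast_eq_one h3) (ψ₂.norm_natCast_eq_one h4) hp3 hn₀ (by omega) h
    have h6 := exponent_le_of_pow_eq (ψ₁.norm_natCast_eq_one h3) (ψ₂.norm_natCast_eq_one h4)
      (χ₁.norm_natCast_eq_one h1) (χ₂.norm_natCast_eq_one h2) hp3 hn₀ (by omega) h.symm
    omega
  set θ := DirichletCharacter.changeLevel
      (show N₁ ∣ (N₁ * N₂) * (M₁ * M₂) from ⟨N₂ * (M₁ * M₂), by ring⟩) χ₁ *
    DirichletCharacter.changeLevel
      (show M₁ ∣ (N₁ * N₂) * (M₁ * M₂) from ⟨(N₁ * N₂) * M₂, by ring⟩)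
      (ψ₁.ringHomComp (starRingEnd ℂ)) with hθ
  have hθp : ∀ p : ℕ, p.Coprime ((N₁ * N₂) * (M₁ * M₂)) →
      (θ ^ 2) (p : ZMod ((N₁ * N₂) * (M₁ * M₂))) =
        (χ₁ (p : ZMod N₁) * starRingEnd ℂ (ψ₁ (p : ZMod M₁))) ^ 2 := fun p hp ↦ by
    rw [MulChar.pow_apply' _ two_ne_zero, hθ, MulChar.mul_apply,
      DirichletCharacter.changeLevel_natCast _ _ hp, DirichletCharacter.changeLevel_natCast _ _ hp,
      MulChar.ringHomComp_apply]
  have hconj : ∀ p : ℕ, p.Coprime ((N₁ * N₂) * (M₁ * M₂)) →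
      ψ₁ (p : ZMod M₁) * starRingEnd ℂ (ψ₁ (p : ZMod M₁)) = 1 := fun p hp ↦ by
    rw [Complex.mul_conj', ψ₁.norm_natCast_eq_one (hcop p hp).2.1]
    norm_num
  have hθ₁ : θ ^ 2 = 1 := by
    obtain ⟨c, hc₀, hc⟩ := χ₂.exists_pos_le_norm_sub hn₀ ψ₂
    refine DirichletCharacter.eq_one_of_primesDensity _ hdens hδ ?_
    filter_upwards [hlarge, tendsto_natCast_atTop_atTop.eventually_gt_atTop (2 / c)]
      with p hp hpc hpp hpS
    obtain ⟨⟨h1, h2⟩, h3, h4⟩ := hcop p (hp hpp)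
    have h := heq p hpS
    rw [sigmaC_prime _ _ _ hpp, sigmaC_prime _ _ _ hpp] at h
    have hp1 : (1 : ℝ) < p := mod_cast hpp.one_lt
    have hpk : (p : ℝ) ≤ (p : ℝ) ^ (k - 1) := le_self_pow₀ hp1.le (by omega)
    have hsq := sq_eq_sq_of_pow_eq (χ₁.norm_natCast_eq_one h1) (ψ₁.norm_natCast_eq_one h3)
      (ψ₂.norm_natCast_eq_one h4) (hprod p) hn₀ (c := c) (Q := (p : ℝ) ^ (k - 1))
      (hp1.trans_le hpk) (by rw [div_lt_iff₀' hc₀] at hpc; nlinarith) (hc _ _) (by simpa using h)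
    rw [hθp p (hp hpp), mul_pow, hsq, ← mul_pow, hconj p (hp hpp), one_pow]
  refine ⟨hθ₁, fun p hpp hpL ↦ ?_⟩
  have hp := (Nat.Prime.coprime_iff_not_dvd hpp).2 hpL
  have h1 := hθp p hp
  rw [hθ₁, MulChar.one_apply ((ZMod.isUnit_iff_coprime _ _).2 hp)] at h1
  have h2 := hconj p hp
  have h3 := hprod p
  rw [sigmaC_prime _ _ _ hpp, sigmaC_prime _ _ _ hpp]
  have hb : ψ₁ (p : ZMod M₁) ≠ 0 := left_ne_zero_of_mul_eq_one h2
  have h4 : χ₁ (p : ZMod N₁) ^ 2 = ψ₁ (p : ZMod M₁) ^ 2 := by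
    calc χ₁ (p : ZMod N₁) ^ 2 = (χ₁ (p : ZMod N₁) * starRingEnd ℂ (ψ₁ (p : ZMod M₁))) ^ 2 *
          ψ₁ (p : ZMod M₁) ^ 2 := by
          rw [← mul_pow, mul_assoc, mul_comm (starRingEnd ℂ _), h2, mul_one]
      _ = _ := by rw [← h1, one_mul]
  rcases sq_eq_sq_iff_eq_or_eq_neg.1 h4 with h5 | h5
  · rw [h5] at h3 ⊢
    rw [mul_left_cancel₀ hb h3]
  · rw [h5, neg_mul, ← mul_neg] at h3
    rw [h5, ← mul_left_cancel₀ hb h3]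
    ring
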